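/- Let v be a non-constant word over A = {a,b}. If the last letter of v is a, then λ_v(a) = λ_{v_+}(ab) = a·ψ(v_+)·b and λ_v(b) = λ_{v^-}(ab) = a·ψ(v^-)·b. If the last letter of v is b, then λ_v(a) = λ_{v^-}(ab) = a·ψ(v^-)·b and λ_v(b) = λ_{v_+}(ab) = a·ψ(v_+)·b. -/

import Mathlib

namespace Chri

/-- Length of the longest palindromic suffix of `w`. -/
def lpsLen (w : List Bool) : ℕ :=
  ((List.range (w.length + 1)).filter
    (fun l => w.drop (w.length - l) == (w.drop (w.length - l)).reverse)).foldr max 0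

/-- Right palindromic closure: the shortest palindrome having `w` as a prefix. -/
def palClosure (w : List Bool) : List Bool :=
  w ++ (w.take (w.length - lpsLen w)).reverse

/-- The iterated palindromization map ψ. -/
def psi (v : List Bool) : List Bool :=
  v.foldl (fun w x => palClosure (w ++ [x])) []

/-- Apply a substitution (morphism of the free monoid) letter by letter. -/
def applyM (f : Bool → List Bool) (w : List Bool) : List Bool := (w.map f).flatten

/-- μ_x : x ↦ x, y ↦ xy (a = false, b = true). -/
def muL (x : Bool) : List Bool → List Bool :=
  applyM (fun y => if y = x then [x] else [x, y])

/-- λ_a = μ_a; λ_b : a ↦ ab, b ↦ b. -/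
def lamL : Bool → List Bool → List Bool
  | false => applyM (fun y => if y = false then [false] else [false, true])
  | true  => applyM (fun y => if y = true then [true] else [false, true])

/-- μ_{v₁⋯v_n} = μ_{v₁} ∘ ⋯ ∘ μ_{v_n}. -/
def muW : List Bool → List Bool → List Bool
  | [], w => w
  | x :: v, w => muL x (muW v w)

/-- λ_{v₁⋯v_n} = λ_{v₁} ∘ ⋯ ∘ λ_{v_n}. -/
def lamW : List Bool → List Bool → List Bool
  | [], w => w
  | x :: v, w => lamL x (lamW v w)

/-- Christoffel words: the letters and the words aψ(v)b. -/
def IsChristoffel (w : List Bool) : Prop :=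
  w = [false] ∨ w = [true] ∨ ∃ v, w = false :: (psi v ++ [true])

/-- A word is constant if it is a power of a single letter. -/
def IsConstant (v : List Bool) : Prop := ∃ x n, v = List.replicate n x

/-- ₊v : the longest proper suffix of v immediately preceded by the complement of
the first letter of v. -/
def plusV (v : List Bool) : List Bool :=
  (v.dropWhile (fun y => y == v.headD false)).tail

/-- v₊ : the longest proper prefix of v immediately followed by the complement of
the last letter of v. -/
def vPlus (v : List Bool) : List Bool := (plusV v.reverse).reverse

/-- α₀: the length of the first maximal block of `v` (the index). -/
def blockLen (v : List Bool) : ℕ :=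
  (v.takeWhile (fun y => y == v.headD false)).length

/-- The list of lengths of the maximal blocks of equal letters of `v`
(the integral representation (α₀, …, α_n)). -/
def blockLens : List Bool → List ℕ
  | [] => []
  | [_] => [1]
  | x :: y :: v =>
    if x = y then
      match blockLens (y :: v) with
      | [] => [1]
      | n :: ns => (n + 1) :: ns
    else 1 :: blockLens (y :: v)

/-- ext(v) = number of maximal blocks of v. -/
def ext (v : List Bool) : ℕ := (blockLens v).length

/-- π(w): the minimal period of `w` (with π(ε) = 1). -/
noncomputable def minPeriod (w : List Bool) : ℕ :=
  sInf {p | 0 < p ∧ ∀ i, i + p < w.length → w.getD i false = w.getD (i + p) false}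

/-- φ_k : a ↦ a^{k+1} b, b ↦ a^k b. -/
def phi (k : ℕ) : List Bool → List Bool :=
  applyM (fun y => if y = false then List.replicate (k + 1) false ++ [true]
                   else List.replicate k false ++ [true])

/-- φ̂_k : a ↦ a b^k, b ↦ a b^{k+1}. -/
def phiHat (k : ℕ) : List Bool → List Bool :=
  applyM (fun y => if y = false then false :: List.replicate k true
                   else false :: List.replicate (k + 1) true)

attribute [local instance] Classical.propDecidable

/-- The derivative ∂w of a proper Christoffel word w = aψ(v)b of index k:
∂(ab) = a, and otherwise the preimage of w under φ_k (if v starts with a)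
or φ̂_k (if v starts with b). -/
noncomputable def derivC (w : List Bool) : List Bool :=
  if w = [false, true] then [false]
  else if h : ∃ v, v ≠ [] ∧ w = false :: (psi v ++ [true]) then
    if h.choose.headD false = false then Function.invFun (phi (blockLen h.choose)) w
    else Function.invFun (phiHat (blockLen h.choose)) w
  else w

/-- The depth of a Christoffel word: the least d with ∂^d w a single letter. -/
noncomputable def depth (w : List Bool) : ℕ :=
  sInf {d | derivC^[d] w = [false] ∨ derivC^[d] w = [true]}

/-- The height h(v): the least n ≥ 1 such that v_(n) is constant, where
v_(1) = v and v_(n+1) = ₊(v_(n)). -/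
noncomputable def height (v : List Bool) : ℕ :=
  sInf {n | 0 < n ∧ IsConstant (plusV^[n - 1] v)}

/-- Helper computing δ_i from (α_{i-1}, δ_{i-1}) along the remaining exponents. -/
def ruleAux : ℕ → ℕ → List ℕ → List ℕ
  | _, _, [] => []
  | pa, pd, a :: rest =>
    let d := if 1 < a then 1 else if 1 < pa then 0 else 1 - pd
    d :: ruleAux a d rest

/-- The sequence δ₀, δ₁, …, δ_n computed by the recursive rule (δ₀ = 1). -/
def ruleSeq : List ℕ → List ℕ
  | [] => []
  | a :: rest => 1 :: ruleAux a 1 rest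

/-- δ(v) = Σ_{i=0}^n δ_i(v), where additionally δ_n(v) = 1; δ(ε) = 1. -/
def delta (v : List Bool) : ℕ := ((ruleSeq (blockLens v)).dropLast).sum + 1

/-- |u₁|: length of the longest prefix x₀⋯x_i of u with i < n and α₀ = ⋯ = α_i = 1
(and 0 if α₀ > 1 or n = 0). -/
def u1len (u : List Bool) : ℕ :=
  min ((blockLens u).takeWhile (fun n => n == 1)).length ((blockLens u).length - 1)

/-- |u₂|: the symmetric notion for suffixes. -/
def u2len (u : List Bool) : ℕ := u1len u.reverse

/-- The sequence H: H(1) = 0, H(2n) = H(n), H(4n±1) = H(n)+1. -/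
def H : ℕ → ℕ
  | 0 => 0
  | 1 => 0
  | n + 2 =>
    if (n + 2) % 2 = 0 then H ((n + 2) / 2)
    else if (n + 2) % 4 = 1 then H ((n + 2) / 4) + 1
    else H ((n + 3) / 4) + 1
decreasing_by all_goals omega

/-- ⟨w⟩: the word w read as an integer in base 2 (a = 0, b = 1). -/
def wordVal (w : List Bool) : ℕ :=
  w.foldl (fun acc x => 2 * acc + (if x then 1 else 0)) 0

/-- Membership in X^*: w is a concatenation of words of X. -/
def InStar (X : Set (List Bool)) (w : List Bool) : Prop :=
  ∃ l : List (List Bool), (∀ u ∈ l, u ∈ X) ∧ w = l.flatten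

/-- w ∈ x⁺. -/
def PowPos (x : Bool) (w : List Bool) : Prop := ∃ k, 0 < k ∧ w = List.replicate k x

/-- The morphism `μ_x` followed by the letter `x`, which commutes with reversal. -/
def muX (x : Bool) (w : List Bool) : List Bool := muL x w ++ [x]

theorem muL_nil (x : Bool) : muL x [] = [] := rfl

theorem muL_cons (x c : Bool) (w : List Bool) :
    muL x (c :: w) = (if c = x then [x] else [x, c]) ++ muL x w := by
  simp [muL, applyM]

theorem muL_append (x : Bool) (u w : List Bool) : muL x (u ++ w) = muL x u ++ muL x w := by
  simp [muL, applyM]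

theorem lamL_append (x : Bool) (u w : List Bool) : lamL x (u ++ w) = lamL x u ++ lamL x w := by
  cases x <;> simp [lamL, applyM]

theorem lamL_false (w : List Bool) : lamL false w = muL false w := by
  rw [lamL, muL]
  congr 1
  funext y
  cases y <;> simp

theorem lamL_true_cons (c : Bool) (w : List Bool) :
    lamL true (c :: w) = (if c = true then [true] else [false, true]) ++ lamL true w := by
  simp [lamL, applyM]

theorem true_cons_lamL_true (w : List Bool) : true :: lamL true w = muX true w := by
  induction w with
  | nil => rfl
  | cons c w ih =>
    rw [lamL_true_cons, muX, muL_cons]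
    rw [muX] at ih
    cases c <;> simp [← ih]

theorem muX_nil (x : Bool) : muX x [] = [x] := rfl

theorem muX_append (x : Bool) (u w : List Bool) : muX x (u ++ w) = muL x u ++ muX x w := by
  simp [muX, muL_append]

theorem muX_cons_self (x : Bool) (w : List Bool) : muX x (x :: w) = x :: muX x w := by
  simp [muX, muL_cons]

theorem muX_cons_not (x : Bool) (w : List Bool) : muX x ((!x) :: w) = x :: (!x) :: muX x w := by
  simp [muX, muL_cons]

theorem muX_eq_cons (x : Bool) (w : List Bool) : ∃ r, muX x w = x :: r := by
  cases w with
  | nil => exact ⟨[], rfl⟩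
  | cons c w =>
    rcases Bool.eq_or_eq_not c x with rfl | rfl
    · exact ⟨_, muX_cons_self _ w⟩
    · exact ⟨_, muX_cons_not _ w⟩

theorem muX_reverse (x : Bool) (w : List Bool) : (muX x w).reverse = muX x w.reverse := by
  induction w with
  | nil => rfl
  | cons c w ih =>
    rw [List.reverse_cons, muX_append, ← List.singleton_append, muX_append, List.reverse_append, ih]
    rcases Bool.eq_or_eq_not c x with rfl | rfl <;> simp [muX, muL_cons, muL_nil]

theorem cons_reverse_muL (x : Bool) (t : List Bool) : x :: (muL x t).reverse = muX x t.reverse := by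
  rw [← muX_reverse]
  simp [muX]

theorem muX_injective (x : Bool) : Function.Injective (muX x) := by
  intro u
  induction u with
  | nil =>
    rintro (_ | ⟨d, w⟩) h
    · rfl
    · obtain ⟨r, hr⟩ := muX_eq_cons x w
      rcases Bool.eq_or_eq_not d x with rfl | rfl
      · simp [muX_nil, muX_cons_self, hr] at h
      · simp [muX_nil, muX_cons_not, hr] at h
  | cons c u ih =>
    obtain ⟨q, hq⟩ := muX_eq_cons x u
    rintro (_ | ⟨d, w⟩) h
    · rcases Bool.eq_or_eq_not c x with rfl | rfl
      · simp [muX_nil, muX_cons_self, hq] at h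
      · simp [muX_nil, muX_cons_not, hq] at h
    · obtain ⟨r, hr⟩ := muX_eq_cons x w
      obtain hc | hc := Bool.eq_or_eq_not c x <;> obtain hd | hd := Bool.eq_or_eq_not d x <;>
        subst hc hd
      · rw [muX_cons_self, muX_cons_self] at h
        rw [ih (List.cons.inj h).2]
      · simp [muX_cons_self, muX_cons_not, hq] at h
      · simp [muX_cons_self, muX_cons_not, hr] at h
      · rw [muX_cons_not, muX_cons_not] at h
        rw [ih (List.cons.inj (List.cons.inj h).2).2]

/-- Every nonempty suffix of `muX x u` comes from a suffix of `u`, up to one missing letter `x`. -/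
theorem suffix_muX {x : Bool} {u l : List Bool} (h : l <:+ muX x u) (hl : l ≠ []) :
    ∃ s, s <:+ u ∧ (l = muX x s ∨ (x :: l = muX x s ∧ l.head? = some (!x))) := by
  induction u with
  | nil =>
    rw [muX_nil, List.suffix_cons_iff] at h
    rcases h with rfl | h
    · exact ⟨[], List.suffix_rfl, Or.inl rfl⟩
    · exact absurd (List.suffix_nil.mp h) hl
  | cons c u ih =>
    have lift (h' : l <:+ muX x u) : ∃ s, s <:+ c :: u ∧
        (l = muX x s ∨ (x :: l = muX x s ∧ l.head? = some (!x))) := by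
      obtain ⟨s, hs, h⟩ := ih h'
      exact ⟨s, hs.trans (List.suffix_cons c u), h⟩
    rcases Bool.eq_or_eq_not c x with rfl | rfl
    · rw [muX_cons_self, List.suffix_cons_iff] at h
      rcases h with rfl | h
      · exact ⟨c :: u, List.suffix_rfl, Or.inl (muX_cons_self c u).symm⟩
      · exact lift h
    · rw [muX_cons_not, List.suffix_cons_iff, List.suffix_cons_iff] at h
      rcases h with rfl | rfl | h
      · exact ⟨(!x) :: u, List.suffix_rfl, Or.inl (muX_cons_not x u).symm⟩
      · exact ⟨(!x) :: u, List.suffix_rfl, Or.inr ⟨(muX_cons_not x u).symm, rfl⟩⟩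
      · exact lift h

theorem muX_length_le_of_suffix {x : Bool} {s u : List Bool} (h : s <:+ u) :
    (muX x s).length ≤ (muX x u).length := by
  obtain ⟨t, rfl⟩ := h
  simp [muX_append]

/-- `s` is the longest palindromic suffix of `w`. -/
def IsLongestPalSuffix (s w : List Bool) : Prop :=
  s <:+ w ∧ s.reverse = s ∧ ∀ l, l <:+ w → l.reverse = l → l.length ≤ s.length

theorem foldr_max_mem (l : List ℕ) (h : l ≠ []) : l.foldr max 0 ∈ l := by
  induction l with
  | nil => exact absurd rfl h
  | cons a l ih =>
    rcases eq_or_ne l [] with rfl | hl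
    · simp
    · rw [List.foldr_cons]
      rcases max_choice a (l.foldr max 0) with h | h <;> rw [h]
      · exact List.mem_cons_self
      · exact List.mem_cons_of_mem _ (ih hl)

theorem le_foldr_max {l : List ℕ} {a : ℕ} (h : a ∈ l) : a ≤ l.foldr max 0 := by
  induction l with
  | nil => simp at h
  | cons b l ih =>
    rcases List.mem_cons.mp h with rfl | h
    · exact le_max_left _ _
    · exact (ih h).trans (le_max_right _ _)

theorem isLongestPalSuffix_drop_lpsLen (w : List Bool) :
    lpsLen w ≤ w.length ∧ IsLongestPalSuffix (w.drop (w.length - lpsLen w)) w := by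
  have hmem := foldr_max_mem ((List.range (w.length + 1)).filter
    (fun l => w.drop (w.length - l) == (w.drop (w.length - l)).reverse))
    (List.ne_nil_of_mem (a := 0) (by simp))
  rw [← lpsLen, List.mem_filter, List.mem_range, beq_iff_eq] at hmem
  have hle : lpsLen w ≤ w.length := by omega
  refine ⟨hle, List.drop_suffix _ _, hmem.2.symm, fun l hl hp => ?_⟩
  have hlen : l.length ≤ lpsLen w := by
    refine le_foldr_max (List.mem_filter.mpr ⟨List.mem_range.mpr ?_, ?_⟩)
    · exact Nat.lt_succ_of_le hl.length_le
    · rw [← List.suffix_iff_eq_drop.mp hl, beq_iff_eq, hp]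
  rw [List.length_drop]
  omega

theorem palClosure_eq {t s : List Bool} (h : IsLongestPalSuffix s (t ++ s)) :
    palClosure (t ++ s) = t ++ s ++ t.reverse := by
  obtain ⟨hle, h1, h2, h3⟩ := isLongestPalSuffix_drop_lpsLen (t ++ s)
  have hs := h3 s h.1 h.2.1
  have hs' := h.2.2 _ h1 h2
  rw [List.length_drop] at hs hs'
  have : (t ++ s).length - lpsLen (t ++ s) = t.length := by
    rw [List.length_append] at *
    omega
  rw [palClosure, this, List.take_left]

theorem exists_longestPalSuffix (w : List Bool) :
    ∃ t s, w = t ++ s ∧ IsLongestPalSuffix s w :=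
  ⟨_, _, (List.take_append_drop _ w).symm, (isLongestPalSuffix_drop_lpsLen w).2⟩

theorem reverse_eq_of_muX {x : Bool} {s : List Bool} (h : (muX x s).reverse = muX x s) :
    s.reverse = s :=
  muX_injective x (by rw [← muX_reverse, h])

theorem muX_length_le_of_pal {x : Bool} {s u r : List Bool} (h : IsLongestPalSuffix s u)
    (hr : r <:+ u) (hp : (muX x r).reverse = muX x r) : (muX x r).length ≤ (muX x s).length :=
  muX_length_le_of_suffix
    (List.suffix_of_suffix_length_le hr h.1 (h.2.2 r hr (reverse_eq_of_muX hp)))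

theorem muX_pal_closure_shape (x : Bool) (t s : List Bool) :
    muX x (t ++ s ++ t.reverse) = muL x t ++ muX x s ++ (muL x t).reverse := by
  rw [List.append_assoc, muX_append, muX_append, ← cons_reverse_muL]
  simp [muX]

theorem palClosure_muX (x : Bool) (u : List Bool) :
    palClosure (muX x u) = muX x (palClosure u) := by
  obtain ⟨t, s, rfl, h⟩ := exists_longestPalSuffix u
  rw [palClosure_eq h, muX_pal_closure_shape, muX_append, palClosure_eq]
  rw [← muX_append]
  refine ⟨by rw [muX_append]; exact List.suffix_append _ _, by rw [muX_reverse, h.2.1], ?_⟩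
  intro l hl hp
  rcases eq_or_ne l [] with rfl | hne
  · simp
  obtain ⟨r, hr, rfl | ⟨-, hhead⟩⟩ := suffix_muX hl hne
  · exact muX_length_le_of_pal h hr hp
  · have hlast : l.getLast? = some x := by
      obtain ⟨k, hk⟩ := hl
      have := congrArg List.getLast? hk
      rwa [List.getLast?_append_of_ne_nil _ hne, muX, List.getLast?_concat] at this
    rw [← hp, List.head?_reverse, hlast] at hhead
    simp at hhead

theorem palClosure_muX_append_not (x : Bool) (w : List Bool) :
    palClosure (muX x w ++ [!x]) = muX x (palClosure (w ++ [!x])) := by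
  have hw : muX x w ++ [!x] = muL x (w ++ [!x]) := by simp [muX, muL_append, muL_cons, muL_nil]
  obtain ⟨t, s, hts, h⟩ := exists_longestPalSuffix (w ++ [!x])
  have hpos : 1 ≤ s.length := h.2.2 [!x] (List.suffix_append _ _) rfl
  have hsne : s ≠ [] := List.ne_nil_of_length_pos hpos
  have hlast : s.getLast? = some (!x) := by
    have := congrArg List.getLast? hts
    rw [List.getLast?_concat, List.getLast?_append_of_ne_nil _ hsne] at this
    exact this.symm
  have hhead : s.head? = some (!x) := by rw [← hlast, ← List.head?_reverse, h.2.1]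
  obtain ⟨s, rfl⟩ : ∃ s', s = (!x) :: s' := by
    cases s with
    | nil => simp at hhead
    | cons c s => simp only [List.head?_cons, Option.some.injEq] at hhead; exact ⟨s, by rw [hhead]⟩
  have hq : muX x ((!x) :: s) = x :: (((!x) :: muL x s) ++ [x]) := by
    simp [muX, muL_cons]
  have hword : muL x (w ++ [!x]) = (muL x t ++ [x]) ++ ((!x) :: muL x s) := by
    simp [hts, muL_append, muL_cons]
  have hqpal : ((!x) :: muL x s).reverse = (!x) :: muL x s := by
    have := muX_reverse x ((!x) :: s)
    rw [h.2.1, hq, List.reverse_cons, List.reverse_append, List.reverse_singleton,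
      List.singleton_append, List.cons_append] at this
    exact List.append_cancel_right (List.cons.inj this).2
  have hlong : IsLongestPalSuffix ((!x) :: muL x s) ((muL x t ++ [x]) ++ ((!x) :: muL x s)) := by
    refine ⟨List.suffix_append _ _, hqpal, fun l hl hp => ?_⟩
    rcases eq_or_ne l [] with rfl | hne
    · simp
    have hsuf : l ++ [x] <:+ muX x (w ++ [!x]) := by
      obtain ⟨k, hk⟩ := hl
      exact ⟨k, by rw [muX, hword, ← hk, List.append_assoc]⟩
    have hllast : l.getLast? = some (!x) := by
      obtain ⟨k, hk⟩ := hl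
      have := congrArg List.getLast? hk
      rwa [← hword, ← hw, List.getLast?_append_of_ne_nil _ hne, List.getLast?_concat] at this
    have hlhead : l.head? = some (!x) := by rw [← hllast, ← List.head?_reverse, hp]
    obtain ⟨r, hr, h' | ⟨h', -⟩⟩ := suffix_muX hsuf (by simp)
    · obtain ⟨r', hr'⟩ := muX_eq_cons x r
      rw [hr'] at h'
      have := congrArg List.head? h'
      rw [List.head?_append, hlhead] at this
      simp at this
    · have hlen := muX_length_le_of_pal (x := x) h hr (by rw [← h']; simp [hp])
      rw [← h', hq] at hlen
      simpa using hlen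
  rw [hw, hword, palClosure_eq hlong, hts, palClosure_eq (hts ▸ h), muX_pal_closure_shape, hq]
  simp

theorem psi_concat (v : List Bool) (y : Bool) : psi (v ++ [y]) = palClosure (psi v ++ [y]) := by
  simp [psi]

/-- Justin's formula for a single letter. -/
theorem psi_cons (x : Bool) (v : List Bool) : psi (x :: v) = muX x (psi v) := by
  induction v using List.reverseRecOn with
  | nil => cases x <;> decide
  | append_singleton v y ih =>
    rw [← List.cons_append, psi_concat, psi_concat, ih]
    rcases Bool.eq_or_eq_not y x with rfl | rfl
    · rw [← palClosure_muX, muX_append]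
      congr 1
      simp [muX, muL_cons, muL_nil]
    · exact palClosure_muX_append_not x _

theorem lamW_false_true (v : List Bool) :
    lamW v [false, true] = false :: (psi v ++ [true]) := by
  induction v with
  | nil => rfl
  | cons x v ih =>
    rw [lamW, ih, psi_cons]
    cases x
    · simp [lamL_false, muL_cons, muL_append, muL_nil, muX]
    · have h : lamL true [true] = [true] := rfl
      rw [lamL_true_cons, lamL_append, ← true_cons_lamL_true, h]
      simp

theorem lamW_append (u v w : List Bool) : lamW (u ++ v) w = lamW u (lamW v w) := by
  induction u with
  | nil => rfl
  | cons x u ih => rw [List.cons_append, lamW, lamW, ih]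

theorem lamL_self (c : Bool) : lamL c [c] = [c] := by
  cases c <;> rfl

theorem lamL_not (c : Bool) : lamL c [!c] = [false, true] := by
  cases c <;> rfl

theorem lamL_not_self (c : Bool) : lamL (!c) [c] = [false, true] := by
  cases c <;> rfl

theorem lamW_replicate_self (n : ℕ) (c : Bool) : lamW (List.replicate n c) [c] = [c] := by
  induction n with
  | zero => rfl
  | succ n ih => rw [List.replicate_succ, lamW, ih, lamL_self]

theorem eq_replicate_or_exists_not (c : Bool) (w : List Bool) :
    (∃ n, w = List.replicate n c) ∨ ∃ n p, w = List.replicate n c ++ (!c) :: p := by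
  induction w with
  | nil => exact Or.inl ⟨0, rfl⟩
  | cons d w ih =>
    rcases Bool.eq_or_eq_not d c with rfl | rfl
    · rcases ih with ⟨n, rfl⟩ | ⟨n, p, rfl⟩
      · exact Or.inl ⟨n + 1, rfl⟩
      · exact Or.inr ⟨n + 1, p, rfl⟩
    · exact Or.inr ⟨0, w, rfl⟩

theorem plusV_cons_replicate (n : ℕ) (c : Bool) (p : List Bool) :
    plusV (c :: (List.replicate n c ++ (!c) :: p)) = p := by
  have h : (List.replicate n c ++ (!c) :: p).dropWhile (fun y => y == c) = (!c) :: p := by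
    rw [List.dropWhile_append_of_pos (by simp +contextual)]
    simp
  simp [plusV, h]

/-- The images of the last letter of `v` and of its complement under `λ_v`. -/
theorem lamW_last {v : List Bool} (hv : ¬ IsConstant v) {c : Bool} (hc : v.getLast? = some c) :
    lamW v [c] = lamW (vPlus v) [false, true] ∧
    lamW v [!c] = lamW v.dropLast [false, true] := by
  obtain ⟨u, rfl⟩ := List.getLast?_eq_some_iff.mp hc
  refine ⟨?_, by rw [List.dropLast_concat, lamW_append]; exact congrArg _ (lamL_not c)⟩
  rcases eq_replicate_or_exists_not c u.reverse with ⟨n, hn⟩ | ⟨n, p, hn⟩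
  · rw [List.reverse_eq_iff, List.reverse_replicate] at hn
    exact absurd ⟨c, n + 1, by rw [hn, List.replicate_succ']⟩ hv
  · have hplus : vPlus (u ++ [c]) = p.reverse := by
      rw [vPlus, List.reverse_append, hn]
      exact congrArg List.reverse (plusV_cons_replicate n c p)
    rw [List.reverse_eq_iff, List.reverse_append, List.reverse_replicate, List.reverse_cons] at hn
    rw [hplus, hn, lamW_append, lamW_append, lamW_append]
    change lamW _ (lamW [!c] (lamW _ (lamL c [c]))) = _
    rw [lamL_self, lamW_replicate_self]
    exact congrArg _ (lamL_not_self c)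

/-- the images of the letters under λ_v, for v non-constant. -/
theorem lamW_letters (v : List Bool) (hv : ¬ IsConstant v) :
    (v.getLast? = some false →
      lamW v [false] = lamW (vPlus v) [false, true] ∧
      lamW (vPlus v) [false, true] = false :: (psi (vPlus v) ++ [true]) ∧
      lamW v [true] = lamW v.dropLast [false, true] ∧
      lamW v.dropLast [false, true] = false :: (psi v.dropLast ++ [true])) ∧
    (v.getLast? = some true →
      lamW v [false] = lamW v.dropLast [false, true] ∧
      lamW v.dropLast [false, true] = false :: (psi v.dropLast ++ [true]) ∧
      lamW v [true] = lamW (vPlus v) [false, true] ∧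
      lamW (vPlus v) [false, true] = false :: (psi (vPlus v) ++ [true])) := by
  refine ⟨fun h => ?_, fun h => ?_⟩
  · obtain ⟨h1, h2⟩ := lamW_last hv h
    exact ⟨h1, lamW_false_true _, h2, lamW_false_true _⟩
  · obtain ⟨h1, h2⟩ := lamW_last hv h
    exact ⟨h2, lamW_false_true _, h1, lamW_false_true _⟩

end Chri
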